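/- Let R be a finite-dimensional complex solvable Leibniz algebra with nilradical N, and let Q be a subspace with R = N ⊕ Q as vector spaces and dim Q = dim(N/N²). Then the center of R is trivial: Center(R) = {0}. -/

import Mathlib

open Module Submodule

universe u v w

/-- A bilinear bracket on `L`. -/
abbrev Bil (L : Type u) [AddCommGroup L] [Module ℂ L] : Type u := L →ₗ[ℂ] L →ₗ[ℂ] L

variable {L : Type u} [AddCommGroup L] [Module ℂ L]

/-- The (right) Leibniz identity. -/
def IsLeibniz (br : Bil L) : Prop :=
  ∀ x y z : L, br (br x y) z = br (br x z) y + br x (br y z)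

/-- The span of all brackets `[S, T]`. -/
def bspan (br : Bil L) (S T : Submodule ℂ L) : Submodule ℂ L :=
  Submodule.span ℂ {z : L | ∃ x ∈ S, ∃ y ∈ T, z = br x y}

/-- `I` is a (two-sided) ideal of the subalgebra `S`. -/
def IsIdealIn (br : Bil L) (S I : Submodule ℂ L) : Prop :=
  I ≤ S ∧ ∀ x ∈ I, ∀ y ∈ S, br x y ∈ I ∧ br y x ∈ I

/-- `I` is a (two-sided) ideal of the whole algebra. -/
abbrev IsIdeal (br : Bil L) (I : Submodule ℂ L) : Prop := IsIdealIn br ⊤ I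

/-- Lower central series of the subalgebra `S`. -/
def lcs (br : Bil L) (S : Submodule ℂ L) : ℕ → Submodule ℂ L
  | 0 => S
  | n + 1 => bspan br (lcs br S n) S

/-- The subalgebra `S` is nilpotent. -/
def IsNilpotentSub (br : Bil L) (S : Submodule ℂ L) : Prop :=
  ∃ n, lcs br S n = ⊥

/-- Derived series of the subalgebra `S`. -/
def derS (br : Bil L) (S : Submodule ℂ L) : ℕ → Submodule ℂ L
  | 0 => S
  | n + 1 => bspan br (derS br S n) (derS br S n)

/-- The subalgebra `S` is solvable. -/
def IsSolvableSub (br : Bil L) (S : Submodule ℂ L) : Prop :=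
  ∃ m, derS br S m = ⊥

/-- `N` is the nilradical (maximal nilpotent ideal) of the subalgebra `S`. -/
def IsNilradicalIn (br : Bil L) (S N : Submodule ℂ L) : Prop :=
  IsIdealIn br S N ∧ IsNilpotentSub br N ∧
    ∀ I : Submodule ℂ L, IsIdealIn br S I → IsNilpotentSub br I → I ≤ N

/-- `N` is the nilradical of the whole algebra. -/
abbrev IsNilradical (br : Bil L) (N : Submodule ℂ L) : Prop := IsNilradicalIn br ⊤ N

/-- `N² = [N, N]`. -/
abbrev sqr (br : Bil L) (N : Submodule ℂ L) : Submodule ℂ L := bspan br N N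

/-- `dim (N / N²)`. -/
noncomputable def dimModSq (br : Bil L) (N : Submodule ℂ L) : ℕ :=
  finrank ℂ (↥N ⧸ (Submodule.comap N.subtype (sqr br N)))

/-- The subalgebra `S` splits as a direct sum of two nonzero ideals. -/
def IsSplitIn (br : Bil L) (S : Submodule ℂ L) : Prop :=
  ∃ A B : Submodule ℂ L, IsIdealIn br S A ∧ IsIdealIn br S B ∧
    A ≠ ⊥ ∧ B ≠ ⊥ ∧ A ⊓ B = ⊥ ∧ A ⊔ B = S

/-- The subalgebra `S` is abelian. -/
def IsAbelianIn (br : Bil L) (S : Submodule ℂ L) : Prop :=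
  ∀ x ∈ S, ∀ y ∈ S, br x y = 0

section Two
variable {L1 : Type v} {L2 : Type w} [AddCommGroup L1] [Module ℂ L1]
  [AddCommGroup L2] [Module ℂ L2]

/-- A bracket-preserving linear isomorphism between the subalgebra `S1` of `L1` and
the subalgebra `S2` of `L2`. -/
def SubAlgIso (br1 : Bil L1) (S1 : Submodule ℂ L1) (br2 : Bil L2) (S2 : Submodule ℂ L2) :
    Prop :=
  ∃ φ : S1 →ₗ[ℂ] L2, Function.Injective φ ∧ Set.range ⇑φ = (S2 : Set L2) ∧
    ∀ x y z : S1, (z : L1) = br1 (x : L1) (y : L1) → φ z = br2 (φ x) (φ y)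

/-- An isomorphism of the two algebras. -/
def AlgIso (br1 : Bil L1) (br2 : Bil L2) : Prop :=
  ∃ φ : L1 ≃ₗ[ℂ] L2, ∀ x y : L1, φ (br1 x y) = br2 (φ x) (φ y)

end Two


/-! ### Lie's theorem for right representations -/

section Rep
attribute [local instance] LieRing.ofAssociativeRing

variable {V : Type w} [AddCommGroup V] [Module ℂ V]

/-- The range of a right representation, as a Lie algebra of endomorphisms. -/
def repRange (br : Bil L) (ρ : L →ₗ[ℂ] Module.End ℂ V)
    (hρ : ∀ y z, ρ (br y z) = ρ z * ρ y - ρ y * ρ z) : LieSubalgebra ℂ (Module.End ℂ V) :=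
  { LinearMap.range ρ with
    lie_mem' := by
      rintro _ _ ⟨y, rfl⟩ ⟨z, rfl⟩
      exact ⟨br z y, by rw [hρ, Ring.lie_def]⟩ }

theorem repRange_solvable (br : Bil L) (hsolv : IsSolvableSub br (⊤ : Submodule ℂ L))
    (ρ : L →ₗ[ℂ] Module.End ℂ V)
    (hρ : ∀ y z, ρ (br y z) = ρ z * ρ y - ρ y * ρ z) :
    LieAlgebra.IsSolvable (repRange br ρ hρ) := by
  obtain ⟨m, hm⟩ := hsolv
  have key : ∀ n, ∀ x ∈ LieAlgebra.derivedSeries ℂ (repRange br ρ hρ) n,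
      ∃ y ∈ derS br ⊤ n, ρ y = (x : Module.End ℂ V) := by
    intro n
    induction n with
    | zero =>
      rintro ⟨_, ⟨y, rfl⟩⟩ _
      exact ⟨y, trivial, rfl⟩
    | succ n ih =>
      intro x hx
      rw [LieAlgebra.derivedSeries_def, LieAlgebra.derivedSeriesOfIdeal_succ,
        ← LieSubmodule.mem_toSubmodule, LieSubmodule.lieIdeal_oper_eq_linear_span'] at hx
      induction hx using Submodule.span_induction with
      | mem x hx =>
        obtain ⟨a, ha, b, hb, rfl⟩ := hx
        obtain ⟨y, hy, hya⟩ := ih a ha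
        obtain ⟨z, hz, hzb⟩ := ih b hb
        refine ⟨br z y, Submodule.subset_span ⟨z, hz, y, hy, rfl⟩, ?_⟩
        rw [hρ, hya, hzb, LieSubalgebra.coe_bracket, Ring.lie_def]
      | zero => exact ⟨0, Submodule.zero_mem _, by simp⟩
      | add a b _ _ h1 h2 =>
        obtain ⟨y, hy, hya⟩ := h1
        obtain ⟨z, hz, hzb⟩ := h2
        exact ⟨y + z, Submodule.add_mem _ hy hz, by simp [hya, hzb]⟩
      | smul c a _ h1 =>
        obtain ⟨y, hy, hya⟩ := h1
        exact ⟨c • y, Submodule.smul_mem _ c hy, by simp [hya]⟩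
  refine LieAlgebra.IsSolvable.mk (R := ℂ) (k := m) ?_
  rw [eq_bot_iff]
  intro x hx
  obtain ⟨y, hy, hyx⟩ := key m x hx
  rw [hm, Submodule.mem_bot] at hy
  subst hy
  rw [LieSubmodule.mem_bot]
  ext1
  simpa using hyx.symm

theorem rep_eigen [FiniteDimensional ℂ V] [Nontrivial V]
    (br : Bil L) (hsolv : IsSolvableSub br (⊤ : Submodule ℂ L))
    (ρ : L →ₗ[ℂ] Module.End ℂ V)
    (hρ : ∀ y z, ρ (br y z) = ρ z * ρ y - ρ y * ρ z) :
    ∃ (χ : L →ₗ[ℂ] ℂ) (v : V), v ≠ 0 ∧ ∀ x, ρ x v = χ x • v := by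
  have := repRange_solvable br hsolv ρ hρ
  obtain ⟨χ, h⟩ := LieModule.exists_nontrivial_weightSpace_of_isSolvable ℂ (repRange br ρ hρ) V
  obtain ⟨⟨v, hv⟩, hv0⟩ := exists_ne (0 : LieModule.weightSpace V χ)
  rw [LieModule.mem_weightSpace] at hv
  let r : L →ₗ[ℂ] (repRange br ρ hρ) :=
    LinearMap.codRestrict (repRange br ρ hρ).toSubmodule ρ (fun x => ⟨x, rfl⟩)
  refine ⟨χ ∘ₗ r, v, fun h => hv0 (by ext1; simpa using h), fun x => hv (r x)⟩

end Rep

/-- Flags coming from Lie's theorem. -/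
theorem rep_flag (br : Bil L) (hsolv : IsSolvableSub br (⊤ : Submodule ℂ L)) (n : ℕ) :
    ∀ (V : Type w) [AddCommGroup V] [Module ℂ V] [FiniteDimensional ℂ V],
    finrank ℂ V = n →
    ∀ (ρ : L →ₗ[ℂ] Module.End ℂ V),
    (∀ y z, ρ (br y z) = ρ z * ρ y - ρ y * ρ z) →
    ∃ (F : ℕ → Submodule ℂ V) (χ : ℕ → L →ₗ[ℂ] ℂ), F 0 = ⊥ ∧ F n = ⊤ ∧
      (∀ i < n, ∀ v ∈ F (i + 1), ∀ x, ρ x v - χ i x • v ∈ F i) ∧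
      (∀ i < n, ∀ y z, χ i (br y z) = 0) ∧
      (∀ i < n, ∀ x, IsNilpotent (ρ x) → χ i x = 0) := by
  induction n with
  | zero =>
    intro V _ _ _ hV ρ hρ
    have : Subsingleton V := finrank_zero_iff.mp hV
    exact ⟨fun _ => ⊥, fun _ => 0, rfl, Subsingleton.elim _ _, by simp, by simp, by simp⟩
  | succ n ih =>
    intro V _ _ _ hV ρ hρ
    have : Nontrivial V := nontrivial_of_finrank_pos (R := ℂ) (by omega)
    obtain ⟨χ₀, v, hv0, hv⟩ := rep_eigen br hsolv ρ hρ
    set W : Submodule ℂ V := ℂ ∙ v with hW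
    have hWi : ∀ x, W ≤ W.comap (ρ x) := by
      intro x w hw
      obtain ⟨c, rfl⟩ := Submodule.mem_span_singleton.mp hw
      rw [Submodule.mem_comap, map_smul, hv]
      exact W.smul_mem _ (W.smul_mem _ (Submodule.mem_span_singleton_self v))
    let ρ' : L →ₗ[ℂ] Module.End ℂ (V ⧸ W) :=
      { toFun := fun x => W.mapQ W (ρ x) (hWi x)
        map_add' := by
          intro x y
          apply Submodule.linearMap_qext
          ext u
          simp
        map_smul' := by
          intro c y
          apply Submodule.linearMap_qext
          ext u
          simp }
    have hρ'a : ∀ x u, ρ' x (W.mkQ u) = W.mkQ (ρ x u) := fun x u => rfl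
    have hρ' : ∀ y z, ρ' (br y z) = ρ' z * ρ' y - ρ' y * ρ' z := by
      intro y z
      apply Submodule.linearMap_qext
      ext u
      simp only [LinearMap.comp_apply, LinearMap.sub_apply, Module.End.mul_apply, hρ'a, hρ, map_sub]
    have hd : finrank ℂ (V ⧸ W) = n := by
      have h1 := W.finrank_quotient_add_finrank
      have h2 : finrank ℂ W = 1 := finrank_span_singleton hv0
      omega
    obtain ⟨F, χ, hF0, hFn, hF, hχ, hnil⟩ := ih (V ⧸ W) hd ρ' hρ'
    refine ⟨fun i => Nat.casesOn i ⊥ (fun j => (F j).comap W.mkQ),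
      fun i => Nat.casesOn i χ₀ χ, rfl, ?_, ?_, ?_, ?_⟩
    · simp [hFn]
    · intro i hi u hu x
      cases i with
      | zero =>
        simp only [hF0, Submodule.mem_comap, Submodule.mem_bot, Submodule.mkQ_apply,
          Submodule.Quotient.mk_eq_zero] at hu
        obtain ⟨c, rfl⟩ := Submodule.mem_span_singleton.mp hu
        change ρ x (c • v) - χ₀ x • c • v ∈ (⊥ : Submodule ℂ V)
        rw [map_smul, hv, smul_comm, sub_self]
        exact Submodule.zero_mem _
      | succ i =>
        have := hF i (by omega) (W.mkQ u) hu x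
        rw [hρ'a, ← map_smul, ← map_sub] at this
        exact this
    · intro i hi y z
      cases i with
      | zero =>
        have h1 := hv (br y z)
        rw [hρ, LinearMap.sub_apply, Module.End.mul_apply, Module.End.mul_apply, hv, hv, map_smul,
          map_smul, hv, hv, smul_comm, sub_self] at h1
        exact (smul_eq_zero.mp h1.symm).resolve_right hv0
      | succ i => exact hχ i (by omega) y z
    · intro i hi x hx
      cases i with
      | zero =>
        obtain ⟨k, hk⟩ := hx
        have : ∀ k, (ρ x ^ k) v = (χ₀ x) ^ k • v := by
          intro k
          induction k with
          | zero => simp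
          | succ k ihk => rw [pow_succ', Module.End.mul_apply, ihk, map_smul, hv, smul_smul, pow_succ]
        have h1 := this k
        rw [hk, LinearMap.zero_apply] at h1
        exact eq_zero_of_pow_eq_zero ((smul_eq_zero.mp h1.symm).resolve_right hv0)
      | succ i =>
        refine hnil i (by omega) x ?_
        obtain ⟨k, hk⟩ := hx
        refine ⟨k, ?_⟩
        have : ∀ k u, (ρ' x ^ k) (W.mkQ u) = W.mkQ ((ρ x ^ k) u) := by
          intro k u
          induction k with
          | zero => simp
          | succ k ihk => rw [pow_succ', Module.End.mul_apply, ihk, hρ'a, pow_succ', Module.End.mul_apply]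
        apply Submodule.linearMap_qext
        ext u
        simp [this, hk, -Submodule.mkQ_apply]

/-! ### The operators `R_x - a` -/

/-- `R_x - a`. -/
noncomputable def Rop (br : Bil L) (x : L) (a : ℂ) : Module.End ℂ L := br.flip x - a • 1

theorem Rop_apply (br : Bil L) (x : L) (a : ℂ) (u : L) : Rop br x a u = br u x - a • u := by
  simp [Rop]

theorem Rop_br (br : Bil L) (hleib : IsLeibniz br) (x : L) (a b : ℂ) (u v : L) :
    Rop br x (a + b) (br u v) = br (Rop br x a u) v + br u (Rop br x b v) := by
  simp only [Rop_apply, hleib u v x, map_sub, LinearMap.sub_apply, map_smul, LinearMap.smul_apply,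
    add_smul]
  abel

theorem lcs_inv (br : Bil L) (hleib : IsLeibniz br) (N : Submodule ℂ L) (hN : IsIdeal br N)
    (x : L) (n : ℕ) : ∀ u ∈ lcs br N n, br u x ∈ lcs br N n := by
  induction n with
  | zero => exact fun u hu => (hN.2 u hu x trivial).1
  | succ n ih =>
    intro u hu
    induction hu using Submodule.span_induction with
    | mem u hu =>
      obtain ⟨a, ha, b, hb, rfl⟩ := hu
      rw [hleib]
      exact Submodule.add_mem _ (Submodule.subset_span ⟨_, ih a ha, _, hb, rfl⟩)
        (Submodule.subset_span ⟨_, ha, _, (hN.2 b hb x trivial).1, rfl⟩)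
    | zero => simp
    | add a b _ _ h1 h2 => simpa using Submodule.add_mem _ h1 h2
    | smul c a _ h => simpa using Submodule.smul_mem _ c h

theorem Rop_inv (br : Bil L) (hleib : IsLeibniz br) (N : Submodule ℂ L) (hN : IsIdeal br N)
    (x : L) (a : ℂ) (n : ℕ) (u : L) (hu : u ∈ lcs br N n) : Rop br x a u ∈ lcs br N n := by
  rw [Rop_apply]
  exact Submodule.sub_mem _ (lcs_inv br hleib N hN x n u hu) (Submodule.smul_mem _ _ hu)

theorem Rop_pow_inv (br : Bil L) (hleib : IsLeibniz br) (N : Submodule ℂ L) (hN : IsIdeal br N)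
    (x : L) (a : ℂ) (n k : ℕ) (u : L) (hu : u ∈ lcs br N n) : (Rop br x a ^ k) u ∈ lcs br N n := by
  induction k with
  | zero => simpa
  | succ k ih => rw [pow_succ', Module.End.mul_apply]; exact Rop_inv br hleib N hN x a n _ ih

theorem br_lcs_sq (br : Bil L) (hleib : IsLeibniz br) (N : Submodule ℂ L) (n : ℕ) (u v : L)
    (hu : u ∈ lcs br N n) (hv : v ∈ lcs br N 1) : br u v ∈ lcs br N (n + 2) := by
  have hmem : ∀ m a b, a ∈ lcs br N m → b ∈ N → br a b ∈ lcs br N (m + 1) :=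
    fun m a b ha hb => Submodule.subset_span ⟨a, ha, b, hb, rfl⟩
  change v ∈ bspan br N N at hv
  induction hv using Submodule.span_induction with
  | mem v hv =>
    obtain ⟨a, ha, b, hb, rfl⟩ := hv
    rw [show br u (br a b) = br (br u a) b - br (br u b) a by rw [hleib u a b]; abel]
    exact Submodule.sub_mem _ (hmem _ _ _ (hmem _ _ _ hu ha) hb)
      (hmem _ _ _ (hmem _ _ _ hu hb) ha)
  | zero => simp
  | add a b _ _ h1 h2 => simpa using Submodule.add_mem _ h1 h2
  | smul c a _ h => simpa using Submodule.smul_mem _ c h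

theorem Rop_pow_br (br : Bil L) (hleib : IsLeibniz br) (N : Submodule ℂ L) (hN : IsIdeal br N)
    (x : L) (a b : ℂ) (n s : ℕ) : ∀ p q, p + q = s → ∀ u ∈ lcs br N n, ∀ v ∈ N,
    (Rop br x a ^ p) u ∈ lcs br N (n + 1) → (Rop br x b ^ q) v ∈ lcs br N 1 →
    (Rop br x (a + b) ^ s) (br u v) ∈ lcs br N (n + 2) := by
  induction s with
  | zero =>
    intro p q hpq u hu v hv hp hq
    obtain rfl : q = 0 := by omega
    exact br_lcs_sq br hleib N n u v hu (by simpa using hq)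
  | succ s ih =>
    intro p q hpq u hu v hv hp hq
    rcases p with _ | p
    · exact Rop_pow_inv br hleib N hN x _ _ _ _
        (Submodule.subset_span ⟨u, by simpa using hp, v, hv, rfl⟩)
    rcases q with _ | q
    · exact Rop_pow_inv br hleib N hN x _ _ _ _
        (br_lcs_sq br hleib N n u v hu (by simpa using hq))
    rw [pow_succ, Module.End.mul_apply, Rop_br br hleib, map_add]
    refine Submodule.add_mem _ ?_ ?_
    · refine ih p (q + 1) (by omega) _ (Rop_inv br hleib N hN x a n u hu) v hv ?_ hq
      rwa [pow_succ, Module.End.mul_apply] at hp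
    · refine ih (p + 1) q (by omega) u hu _ (Rop_inv br hleib N hN x b 0 v hv) hp ?_
      rwa [pow_succ, Module.End.mul_apply] at hq

theorem Rop_pow_lcs (br : Bil L) (hleib : IsLeibniz br) (N : Submodule ℂ L) (hN : IsIdeal br N)
    (x : L) (a : ℂ) (m : ℕ) (hm : ∀ v ∈ N, (Rop br x a ^ m) v ∈ lcs br N 1) (n : ℕ) :
    ∃ k, ∀ v ∈ lcs br N n, (Rop br x ((n + 1 : ℕ) * a) ^ k) v ∈ lcs br N (n + 1) := by
  induction n with
  | zero => exact ⟨m, fun v hv => by simpa using hm v hv⟩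
  | succ n ih =>
    obtain ⟨k, hk⟩ := ih
    refine ⟨k + m, fun v hv => ?_⟩
    rw [show ((n + 1 + 1 : ℕ) * a) = (n + 1 : ℕ) * a + a by push_cast; ring]
    induction hv using Submodule.span_induction with
    | mem v hv =>
      obtain ⟨c, hc, d, hd, rfl⟩ := hv
      exact Rop_pow_br br hleib N hN x _ _ n _ k m rfl c hc d hd (hk c hc) (hm d hd)
    | zero => simp
    | add a b _ _ h1 h2 => simpa using Submodule.add_mem _ h1 h2
    | smul c a _ h => simpa using Submodule.smul_mem _ c h

theorem eigen_zero (br : Bil L) (hleib : IsLeibniz br) (N : Submodule ℂ L) (hN : IsIdeal br N)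
    (hnil : IsNilpotentSub br N)
    (x : L) (a : ℂ) (m : ℕ) (hm : ∀ v ∈ N, (Rop br x a ^ m) v ∈ lcs br N 1)
    (μ : ℂ) (hμ : ∀ n : ℕ, μ ≠ (n + 1 : ℕ) * a) (v : L) (hv : v ∈ N) (hvμ : br v x = μ • v) :
    v = 0 := by
  obtain ⟨d, hd⟩ := hnil
  have key : ∀ n, v ∈ lcs br N n := by
    intro n
    induction n with
    | zero => exact hv
    | succ n ih =>
      obtain ⟨k, hk⟩ := Rop_pow_lcs br hleib N hN x a m hm n
      have h1 := hk v ih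
      have h2 : ∀ k, (Rop br x ((n + 1 : ℕ) * a) ^ k) v = (μ - (n + 1 : ℕ) * a) ^ k • v := by
        intro k
        induction k with
        | zero => simp
        | succ k ihk =>
          rw [pow_succ', Module.End.mul_apply, ihk, map_smul, Rop_apply, hvμ, ← sub_smul, smul_smul,
            pow_succ]
      rw [h2] at h1
      exact (Submodule.smul_mem_iff _ (pow_ne_zero _ (sub_ne_zero.mpr (hμ n)))).mp h1
  have := key d
  rwa [hd, Submodule.mem_bot] at this

theorem nilp_of_eigen {V : Type w} [AddCommGroup V] [Module ℂ V] [FiniteDimensional ℂ V]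
    (f : Module.End ℂ V) (h : ∀ (μ : ℂ) v, μ ≠ 0 → f v = μ • v → v = 0) : IsNilpotent f := by
  have h1 : ∀ μ : ℂ, μ ≠ 0 → f.maxGenEigenspace μ = ⊥ := by
    intro μ hμ
    by_contra hne
    have h2 : f.HasEigenvalue μ := by
      obtain ⟨v, hv, hv0⟩ := Submodule.exists_mem_ne_zero_of_ne_bot hne
      rw [Module.End.mem_maxGenEigenspace] at hv
      obtain ⟨k, hk⟩ := hv
      refine Module.End.hasEigenvalue_of_hasGenEigenvalue (k := k) ?_
      intro hb
      apply hv0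
      have : v ∈ f.genEigenspace μ k := by
        rw [Module.End.mem_genEigenspace_nat]; exact hk
      rwa [hb, Submodule.mem_bot] at this
    obtain ⟨v, hv⟩ := h2.exists_hasEigenvector
    exact hv.2 (h μ v hμ hv.apply_eq_smul)
  have h3 := Module.End.iSup_maxGenEigenspace_eq_top f
  have h4 : f.maxGenEigenspace 0 = ⊤ := by
    rw [eq_top_iff, ← h3]
    refine iSup_le fun μ => ?_
    by_cases hμ : μ = 0
    · rw [hμ]
    · rw [h1 μ hμ]; exact bot_le
  refine ⟨finrank ℂ V, ?_⟩
  ext v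
  have : v ∈ f.maxGenEigenspace 0 := h4 ▸ trivial
  rw [Module.End.maxGenEigenspace_eq_genEigenspace_finrank, Module.End.mem_genEigenspace_nat] at this
  simpa using this

/-- Elements acting nilpotently from the right, and all brackets, lie in the nilradical. -/
theorem nilrad_facts [FiniteDimensional ℂ L]
    (br : Bil L) (hleib : IsLeibniz br) (hsolv : IsSolvableSub br (⊤ : Submodule ℂ L))
    (N : Submodule ℂ L) (hN : IsNilradical br N) :
    (∀ x, IsNilpotent (br.flip x) → x ∈ N) ∧ ∀ x y, br x y ∈ N := by
  obtain ⟨F, χ, hF0, hFn, hF, hχ, hnil⟩ := rep_flag br hsolv _ L rfl br.flip (by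
    intro y z
    ext u
    simp [hleib u y z])
  set d := finrank ℂ L
  let J : Submodule ℂ L := ⨅ i : Fin d, LinearMap.ker (χ i)
  have hJ : ∀ x, x ∈ J ↔ ∀ i < d, χ i x = 0 := by
    intro x
    simp only [J, Submodule.mem_iInf, LinearMap.mem_ker]
    exact ⟨fun h i hi => h ⟨i, hi⟩, fun h i => h i i.2⟩
  have hbr : ∀ x y, br x y ∈ J := fun x y => (hJ _).mpr fun i hi => hχ i hi x y
  have hJN : J ≤ N := by
    refine hN.2.2 J ⟨le_top, fun x _ y _ => ⟨hbr _ _, hbr _ _⟩⟩ ⟨d, ?_⟩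
    have key : ∀ n ≤ d, lcs br J n ≤ F (d - n) := by
      intro n
      induction n with
      | zero => intro _; rw [Nat.sub_zero, hFn]; exact le_top
      | succ n ih =>
        intro hn
        refine Submodule.span_le.mpr ?_
        rintro _ ⟨u, hu, x, hx, rfl⟩
        have h1 := ih (by omega) hu
        rw [show d - n = (d - (n + 1)) + 1 by omega] at h1
        have h2 := hF (d - (n + 1)) (by omega) u h1 x
        rw [(hJ x).mp hx _ (by omega)] at h2
        simpa using h2
    have := key d le_rfl
    rwa [Nat.sub_self, hF0, le_bot_iff] at this
  exact ⟨fun x hx => hJN ((hJ x).mpr fun i hi => hnil i hi x hx), fun x y => hJN (hbr x y)⟩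

/-- Weights on `N / N²`. -/
theorem weights [FiniteDimensional ℂ L]
    (br : Bil L) (hleib : IsLeibniz br) (hsolv : IsSolvableSub br (⊤ : Submodule ℂ L))
    (N : Submodule ℂ L) (hN : IsIdeal br N) :
    ∃ χ : ℕ → L →ₗ[ℂ] ℂ, (∀ i < dimModSq br N, ∀ x ∈ N, χ i x = 0) ∧
      ∀ x a, (∀ i < dimModSq br N, χ i x = a) →
        ∀ v ∈ N, (Rop br x a ^ dimModSq br N) v ∈ lcs br N 1 := by
  set P : Submodule ℂ N := Submodule.comap N.subtype (sqr br N) with hP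
  have hr : ∀ x, ∀ u ∈ N, br.flip x u ∈ N := fun x u hu => (hN.2 u hu x trivial).1
  have hPi : ∀ x, P ≤ P.comap ((br.flip x).restrict (hr x)) := by
    intro x u hu
    exact lcs_inv br hleib N hN x 1 u hu
  let ρ : L →ₗ[ℂ] Module.End ℂ (N ⧸ P) :=
    { toFun := fun x => P.mapQ P ((br.flip x).restrict (hr x)) (hPi x)
      map_add' := by
        intro x y
        apply Submodule.linearMap_qext
        ext1 u
        change P.mkQ _ = P.mkQ _ + P.mkQ _
        rw [← map_add]
        congr 1
        ext1
        simp
      map_smul' := by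
        intro c y
        apply Submodule.linearMap_qext
        ext1 u
        change P.mkQ _ = c • P.mkQ _
        rw [← map_smul]
        congr 1
        ext1
        simp }
  have hρa : ∀ x (u : N), ρ x (P.mkQ u) = P.mkQ ⟨br u x, hr x u u.2⟩ := fun x u => rfl
  have hρ : ∀ y z, ρ (br y z) = ρ z * ρ y - ρ y * ρ z := by
    intro y z
    apply Submodule.linearMap_qext
    ext1 u
    simp only [LinearMap.comp_apply, LinearMap.sub_apply, Module.End.mul_apply, hρa, ← map_sub]
    congr 1
    ext1
    simp [hleib (u : L) y z]
  obtain ⟨F, χ, hF0, hFn, hF, hχ, hnil⟩ := rep_flag br hsolv _ (N ⧸ P) rfl ρ hρ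
  refine ⟨χ, ?_, ?_⟩
  · intro i hi x hx
    refine hnil i hi x ⟨1, ?_⟩
    rw [pow_one]
    apply Submodule.linearMap_qext
    ext1 u
    rw [LinearMap.comp_apply, hρa, LinearMap.comp_apply, LinearMap.zero_apply, Submodule.mkQ_apply,
      Submodule.Quotient.mk_eq_zero]
    exact Submodule.subset_span ⟨u, u.2, x, hx, rfl⟩
  · intro x a hx v hv
    have key : ∀ i ≤ dimModSq br N, ∀ v : N, P.mkQ v ∈ F i → (Rop br x a ^ i) v ∈ lcs br N 1 := by
      intro i
      induction i with
      | zero =>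
        intro _ v hv
        rw [hF0, Submodule.mem_bot, Submodule.mkQ_apply, Submodule.Quotient.mk_eq_zero] at hv
        exact hv
      | succ i ih =>
        intro hi v hv
        have h1 := hF i hi _ hv x
        rw [hx i hi, hρa, ← map_smul, ← map_sub] at h1
        have h2 := ih (by omega) _ h1
        rw [pow_succ, Module.End.mul_apply, Rop_apply]
        exact h2
    refine key _ le_rfl ⟨v, hv⟩ ?_
    have : F (dimModSq br N) = ⊤ := hFn
    rw [this]
    trivial

/-- Proposition 6.1. A solvable Leibniz algebra `R = N ⊕ Q` with
nilradical `N` and `dim Q = dim (N/N²)` has trivial center. -/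
theorem stmt9 {L : Type u} [AddCommGroup L] [Module ℂ L] [FiniteDimensional ℂ L]
    (br : Bil L) (hleib : IsLeibniz br) (hsolv : IsSolvableSub br (⊤ : Submodule ℂ L))
    (N Q : Submodule ℂ L) (hN : IsNilradical br N) (hQ : IsCompl N Q)
    (hdimQ : finrank ℂ Q = dimModSq br N) :
    {c : L | ∀ y : L, br c y = 0 ∧ br y c = 0} = {(0 : L)} := by
  obtain ⟨hnil, hbr⟩ := nilrad_facts br hleib hsolv N hN
  obtain ⟨χ, hχN, hχ⟩ := weights br hleib hsolv N hN.1
  set k := dimModSq br N with hk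
  let X : L →ₗ[ℂ] (Fin k → ℂ) := LinearMap.pi fun i => χ i
  have hker : LinearMap.ker X = N := by
    apply le_antisymm
    · intro x hx
      have hx0 : ∀ i < k, χ i x = 0 := fun i hi => congrFun (LinearMap.mem_ker.mp hx) ⟨i, hi⟩
      refine hnil x (nilp_of_eigen _ ?_)
      intro μ v hμ hv
      rw [LinearMap.flip_apply] at hv
      refine eigen_zero br hleib N hN.1 hN.2.1 x 0 k (hχ x 0 hx0) μ (by simpa using hμ) v ?_ hv
      have h1 := hbr v x
      rw [hv] at h1
      exact (Submodule.smul_mem_iff _ hμ).mp h1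
    · intro x hx
      rw [LinearMap.mem_ker]
      ext i
      exact hχN i i.2 x hx
  have hsurj : LinearMap.range X = ⊤ := by
    apply Submodule.eq_top_of_finrank_eq
    have h1 := LinearMap.finrank_range_add_finrank_ker X
    have h2 := Submodule.finrank_add_eq_of_isCompl hQ
    rw [hker] at h1
    rw [Module.finrank_fin_fun]
    omega
  obtain ⟨x, hx⟩ := LinearMap.range_eq_top.mp hsurj (fun _ => 1)
  have hx1 : ∀ i < k, χ i x = 1 := fun i hi => congrFun hx ⟨i, hi⟩
  ext c
  simp only [Set.mem_ofPred_eq, Set.mem_singleton_iff]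
  constructor
  · intro hc
    have hcN : c ∈ N := by
      refine hnil c ⟨1, ?_⟩
      rw [pow_one]
      ext y
      simpa using (hc y).2
    refine eigen_zero br hleib N hN.1 hN.2.1 x 1 k (hχ x 1 hx1) 0 ?_ c hcN (by simpa using (hc x).1)
    intro n h
    rw [mul_one] at h
    exact absurd (Nat.cast_eq_zero.mp h.symm) (Nat.succ_ne_zero n)
  · rintro rfl y
    simp
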